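/- Under Assumption 1, for every ε ∈ (0,1/2] and κ ∈ (0,1/2], the Markov chain {P^ε} induced by PHPIP on the state space B is irreducible (every state of B is accessible from every state of B) and aperiodic (every state has period 1). -/

import Mathlib

open Filter Topology Set

attribute [local instance] Classical.propDecidable

section PHPIP

variable {ι : Type*} [Fintype ι] [DecidableEq ι] {A : ι → Type*} [∀ i, Fintype (A i)]

/-- Assumption 1 on the constraint maps. -/
def Assumption1 (C : ∀ i, A i → Finset (A i)) : Prop :=
  (∀ (i : ι) (a b : A i), b ∈ C i a ↔ a ∈ C i b) ∧
  (∀ (i : ι) (a b : A i), ∃ (nf : ℕ) (f : ℕ → A i), f 0 = a ∧ f nf = b ∧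
      ∀ k < nf, f (k + 1) ∈ C i (f k)) ∧
  (∀ (i : ι) (a : A i), 3 ≤ (C i a).card)

/-- Assumption 3: unilateral constrained deviations change the utility by less than 1/2. -/
def Assumption3 (U : ι → (∀ i, A i) → ℝ) (C : ∀ i, A i → Finset (A i)) : Prop :=
  ∀ (i : ι) (a : ∀ j, A j) (b : A i), b ∈ C i (a i) →
    U i (Function.update a i b) - U i a < 1 / 2

/-- Γ is a constrained potential game with potential function φ. -/
def IsPotentialGame (U : ι → (∀ i, A i) → ℝ) (C : ∀ i, A i → Finset (A i))
    (φ : (∀ i, A i) → ℝ) : Prop :=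
  ∀ (i : ι) (a : ∀ j, A j) (b : A i), b ∈ C i (a i) →
    U i (Function.update a i b) - U i a = φ (Function.update a i b) - φ a

/-- Probability that, from state `(a0, a1)`, player `i` selects the action `x`
under the PHPIP selection rule with exploration rate `ε` and parameter `κ`. -/
noncomputable def selProb (κ : ℝ) (U : ι → (∀ i, A i) → ℝ)
    (C : ∀ i, A i → Finset (A i)) (ε : ℝ) (a0 a1 : ∀ i, A i) (i : ι) (x : A i) : ℝ :=
  if U i a0 ≤ U i a1 then
    (if x = a1 i then 1 - ε else 0) +
      (if x ∈ (C i (a1 i)).erase (a1 i) then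
        ε / ((C i (a1 i)).erase (a1 i)).card else 0)
  else
    (if x = a1 i then (1 - ε) * (κ * ε ^ (U i a0 - U i a1)) else 0) +
      (if x = a0 i then (1 - ε) * (1 - κ * ε ^ (U i a0 - U i a1)) else 0) +
      (if x ∈ ((C i (a1 i)).erase (a1 i)).erase (a0 i) then
        ε / (((C i (a1 i)).erase (a1 i)).erase (a0 i)).card else 0)

/-- One-step transition probability of the Markov chain `{P^ε}` induced by PHPIP
on pairs of joint actions. -/
noncomputable def phTrans (κ : ℝ) (U : ι → (∀ i, A i) → ℝ)
    (C : ∀ i, A i → Finset (A i)) (ε : ℝ)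
    (z1 z2 : (∀ i, A i) × (∀ i, A i)) : ℝ :=
  if z2.1 = z1.2 then ∏ i, selProb κ U C ε z1.1 z1.2 i (z2.2 i) else 0

/-- The state space B. -/
def memB (C : ∀ i, A i → Finset (A i)) (z : (∀ i, A i) × (∀ i, A i)) : Prop :=
  ∀ i, z.2 i ∈ C i (z.1 i)

/-- k-step transition probabilities of the homogeneous chain `{P^ε}`. -/
noncomputable def phTransPow (κ : ℝ) (U : ι → (∀ i, A i) → ℝ)
    (C : ∀ i, A i → Finset (A i)) (ε : ℝ) :
    ℕ → (∀ i, A i) × (∀ i, A i) → (∀ i, A i) × (∀ i, A i) → ℝ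
  | 0, z, z' => if z = z' then 1 else 0
  | k + 1, z, z' => ∑ w : (∀ i, A i) × (∀ i, A i),
      phTrans κ U C ε z w * phTransPow κ U C ε k w z'

/-- Probability of a path (sequence of states) of the chain `{P^ε}`. -/
noncomputable def pathProb (κ : ℝ) (U : ι → (∀ i, A i) → ℝ)
    (C : ∀ i, A i → Finset (A i)) (ε : ℝ) :
    List ((∀ i, A i) × (∀ i, A i)) → ℝ
  | [] => 1
  | [_] => 1
  | z :: z' :: rest => phTrans κ U C ε z z' * pathProb κ U C ε (z' :: rest)

/-- A transition is feasible if it has positive probability for some ε ∈ (0,1/2]. -/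
def Feasible (κ : ℝ) (U : ι → (∀ i, A i) → ℝ) (C : ∀ i, A i → Finset (A i))
    (z z' : (∀ i, A i) × (∀ i, A i)) : Prop :=
  ∃ ε : ℝ, 0 < ε ∧ ε ≤ 1 / 2 ∧ 0 < phTrans κ U C ε z z'

/-- `l` is a (feasible) path of the chain from `z1` to `z2`. -/
def IsPath (κ : ℝ) (U : ι → (∀ i, A i) → ℝ) (C : ∀ i, A i → Finset (A i))
    (z1 z2 : (∀ i, A i) × (∀ i, A i)) (l : List ((∀ i, A i) × (∀ i, A i))) : Prop :=
  l.head? = some z1 ∧ l.getLast? = some z2 ∧ l.Chain' (Feasible κ U C)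

/-- `r` is the resistance of the path `l`:  `lim_{ε→0+} P^ε(l)/ε^r ∈ (0,∞)`. -/
def IsPathRes (κ : ℝ) (U : ι → (∀ i, A i) → ℝ) (C : ∀ i, A i → Finset (A i))
    (l : List ((∀ i, A i) × (∀ i, A i))) (r : ℝ) : Prop :=
  ∃ L : ℝ, 0 < L ∧
    Tendsto (fun ε : ℝ => pathProb κ U C ε l / ε ^ r) (𝓝[>] (0 : ℝ)) (𝓝 L)

/-- `(a, b)` (as diagonal states `((a,a),(b,b))`) is a pair in `E_s`:
exactly one player deviates and the deviation is feasible. -/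
def EsPair (C : ∀ i, A i → Finset (A i)) (a b : ∀ i, A i) : Prop :=
  (∃! i, a i ≠ b i) ∧ ∀ i, a i ≠ b i → b i ∈ C i (a i)

/-- The path (list of states) of the M-straight-route through the given diagonal nodes. -/
def msrPath : List (∀ i, A i) → List ((∀ i, A i) × (∀ i, A i))
  | [] => []
  | [a] => [(a, a)]
  | a :: b :: rest => (a, a) :: (a, b) :: msrPath (b :: rest)

/-- Weight of the edge of the graph `G_R` from `z` to `z'`: the minimal resistance
among all paths of `{P^ε}` from `z` to `z'`. -/
noncomputable def edgeWeight (κ : ℝ) (U : ι → (∀ i, A i) → ℝ)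
    (C : ∀ i, A i → Finset (A i)) (z z' : (∀ i, A i) × (∀ i, A i)) : ℝ :=
  sInf {r : ℝ | ∃ l, IsPath κ U C z z' l ∧ IsPathRes κ U C l r}

/-- `y` is reachable from `x` in at most `d` constraint-feasible steps. -/
def ReachIn (C : ∀ i, A i → Finset (A i)) (i : ι) : ℕ → A i → A i → Prop
  | 0, x, y => x = y
  | d + 1, x, y => ReachIn C i d x y ∨ ∃ w, ReachIn C i d x w ∧ y ∈ C i w

/-- Inhomogeneous products: `transProd κ U C εs k0 m` is the transition matrix
`P(k0, k0 + m) = ∏_{k'=k0}^{k0+m-1} P_{k'}` of the PIPIP chain with exploration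
rates `εs`. -/
noncomputable def transProd (κ : ℝ) (U : ι → (∀ i, A i) → ℝ)
    (C : ∀ i, A i → Finset (A i)) (εs : ℕ → ℝ) (k0 : ℕ) :
    ℕ → (∀ i, A i) × (∀ i, A i) → (∀ i, A i) × (∀ i, A i) → ℝ
  | 0, z, z' => if z = z' then 1 else 0
  | m + 1, z, z' => ∑ w : (∀ i, A i) × (∀ i, A i),
      transProd κ U C εs k0 m z w * phTrans κ U C (εs (k0 + m)) w z'

/-- The PIPIP exploration rate `ε(k) = k^{-1/(n(D+1))}`. -/
noncomputable def pipipRate (n D : ℕ) (k : ℕ) : ℝ :=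
  (k : ℝ) ^ (-(1 : ℝ) / ((n : ℝ) * ((D : ℝ) + 1)))

/-- Accessibility along the unperturbed chain `{P^0}`. -/
def Accessible0 (κ : ℝ) (U : ι → (∀ i, A i) → ℝ) (C : ∀ i, A i → Finset (A i))
    (z z' : (∀ i, A i) × (∀ i, A i)) : Prop :=
  ∃ k : ℕ, 0 < phTransPow κ U C 0 k z z'

/-- A recurrent communication class of the unperturbed chain `{P^0}`. -/
def IsRecClass (κ : ℝ) (U : ι → (∀ i, A i) → ℝ) (C : ∀ i, A i → Finset (A i))
    (H : Set ((∀ i, A i) × (∀ i, A i))) : Prop :=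
  H.Nonempty ∧ (∀ z ∈ H, ∀ z' ∈ H, Accessible0 κ U C z z') ∧
    (∀ z ∈ H, ∀ z', Accessible0 κ U C z z' → z' ∈ H)

end PHPIP

section Lemmas

variable {ι : Type*} {A : ι → Type*}
  {U : ι → (∀ i, A i) → ℝ} {C : ∀ i, A i → Finset (A i)} {κ ε : ℝ}

theorem selProb_nonneg (hκ0 : 0 < κ) (hκ : κ ≤ 1 / 2) (hε0 : 0 < ε) (hε : ε ≤ 1 / 2)
    (a0 a1 : ∀ i, A i) (i : ι) (x : A i) : 0 ≤ selProb κ U C ε a0 a1 i x := by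
  have h1 : 0 ≤ 1 - ε := by linarith
  unfold selProb
  by_cases hU : U i a0 ≤ U i a1
  · rw [if_pos hU]
    positivity
  · have hpow : ε ^ (U i a0 - U i a1) ≤ 1 :=
      Real.rpow_le_one hε0.le (by linarith) (by linarith)
    have h2 : 0 ≤ 1 - κ * ε ^ (U i a0 - U i a1) := by nlinarith
    rw [if_neg hU]
    positivity

theorem selProb_self_pos (hκ0 : 0 < κ) (hκ : κ ≤ 1 / 2) (hε0 : 0 < ε) (hε : ε ≤ 1 / 2)
    (a0 a1 : ∀ i, A i) (i : ι) : 0 < selProb κ U C ε a0 a1 i (a1 i) := by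
  have h1 : 0 < 1 - ε := by linarith
  unfold selProb
  by_cases hU : U i a0 ≤ U i a1
  · simp [hU, h1]
  · have hpow : ε ^ (U i a0 - U i a1) ≤ 1 :=
      Real.rpow_le_one hε0.le (by linarith) (by linarith)
    have h2 : 0 ≤ 1 - κ * ε ^ (U i a0 - U i a1) := by nlinarith
    simp only [hU, if_false, if_true, Finset.mem_erase, ne_eq, not_true_eq_false, false_and,
      and_false]
    split_ifs <;> positivity

theorem selProb_diag_pos (hε0 : 0 < ε) (hε : ε ≤ 1 / 2) (a : ∀ i, A i) (i : ι) (x : A i)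
    (hx : x = a i ∨ x ∈ C i (a i)) : 0 < selProb κ U C ε a a i x := by
  have h1 : 0 < 1 - ε := by linarith
  unfold selProb
  by_cases hxa : x = a i
  · simp [hxa, h1]
  · have hmem : x ∈ (C i (a i)).erase (a i) :=
      Finset.mem_erase.2 ⟨hxa, hx.resolve_left hxa⟩
    have hcard : 0 < ((C i (a i)).erase (a i)).card := Finset.card_pos.2 ⟨x, hmem⟩
    rw [if_pos le_rfl, if_neg hxa, if_pos hmem, zero_add]
    positivity

variable [Fintype ι]

theorem phTrans_nonneg (hκ0 : 0 < κ) (hκ : κ ≤ 1 / 2) (hε0 : 0 < ε) (hε : ε ≤ 1 / 2)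
    (z w : (∀ i, A i) × (∀ i, A i)) : 0 ≤ phTrans κ U C ε z w := by
  unfold phTrans
  split_ifs
  · exact Finset.prod_nonneg fun i _ => selProb_nonneg hκ0 hκ hε0 hε _ _ _ _
  · exact le_rfl

/-- With positive probability every player repeats its last action. -/
theorem phTrans_repeat_pos (hκ0 : 0 < κ) (hκ : κ ≤ 1 / 2) (hε0 : 0 < ε) (hε : ε ≤ 1 / 2)
    (a0 a1 : ∀ i, A i) : 0 < phTrans κ U C ε (a0, a1) (a1, a1) := by
  unfold phTrans
  rw [if_pos rfl]
  exact Finset.prod_pos fun i _ => selProb_self_pos hκ0 hκ hε0 hε _ _ _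

theorem phTrans_diag_pos (hε0 : 0 < ε) (hε : ε ≤ 1 / 2) (a b : ∀ i, A i)
    (hab : ∀ i, b i = a i ∨ b i ∈ C i (a i)) : 0 < phTrans κ U C ε (a, a) (a, b) := by
  unfold phTrans
  rw [if_pos rfl]
  exact Finset.prod_pos fun i _ => selProb_diag_pos hε0 hε _ _ _ (hab i)

/-- Any two joint actions are connected by a sequence of joint moves in which every player
either stays put or makes a feasible move. -/
theorem Assumption1.exists_joint_path (hA1 : Assumption1 C) (a b : ∀ i, A i) :
    ∃ (N : ℕ) (F : ℕ → ∀ i, A i), F 0 = a ∧ F N = b ∧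
      ∀ k i, F (k + 1) i = F k i ∨ F (k + 1) i ∈ C i (F k i) := by
  choose nf f hf0 hfn hf using fun i => hA1.2.1 i (a i) (b i)
  refine ⟨∑ i, nf i, fun k i => f i (min k (nf i)), ?_, ?_, fun k i => ?_⟩
  · ext i; simp [hf0]
  · ext i
    simp only
    rw [min_eq_right (Finset.single_le_sum (f := nf) (fun _ _ => Nat.zero_le _)
      (Finset.mem_univ i)), hfn]
  · rcases lt_or_ge k (nf i) with h | h
    · right
      simpa [min_eq_left h.le, min_eq_left (Nat.succ_le_of_lt h)] using hf i k h
    · left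
      simp only [min_eq_right h, min_eq_right (h.trans k.le_succ)]

variable [DecidableEq ι] [∀ i, Fintype (A i)]

theorem phTransPow_nonneg (hκ0 : 0 < κ) (hκ : κ ≤ 1 / 2) (hε0 : 0 < ε) (hε : ε ≤ 1 / 2)
    (k : ℕ) (z z' : (∀ i, A i) × (∀ i, A i)) : 0 ≤ phTransPow κ U C ε k z z' := by
  induction k generalizing z with
  | zero => unfold phTransPow; split_ifs <;> norm_num
  | succ k ih =>
    exact Finset.sum_nonneg fun w _ => mul_nonneg (phTrans_nonneg hκ0 hκ hε0 hε z w) (ih w)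

theorem phTransPow_succ_pos (hκ0 : 0 < κ) (hκ : κ ≤ 1 / 2) (hε0 : 0 < ε) (hε : ε ≤ 1 / 2)
    {k : ℕ} {z w z' : (∀ i, A i) × (∀ i, A i)} (hzw : 0 < phTrans κ U C ε z w)
    (hwz : 0 < phTransPow κ U C ε k w z') : 0 < phTransPow κ U C ε (k + 1) z z' :=
  Finset.sum_pos' (fun v _ => mul_nonneg (phTrans_nonneg hκ0 hκ hε0 hε z v)
    (phTransPow_nonneg hκ0 hκ hε0 hε k v z')) ⟨w, Finset.mem_univ _, mul_pos hzw hwz⟩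

theorem exists_phTransPow_diag_pos (hκ0 : 0 < κ) (hκ : κ ≤ 1 / 2) (hε0 : 0 < ε)
    (hε : ε ≤ 1 / 2) (hA1 : Assumption1 C) (a : ∀ i, A i) {z : (∀ i, A i) × (∀ i, A i)}
    (hz : memB C z) : ∃ k : ℕ, 0 < phTransPow κ U C ε k (a, a) z := by
  obtain ⟨N, F, rfl, hFN, hF⟩ := hA1.exists_joint_path a z.1
  have hdiag (n : ℕ) : ∀ m, m + n = N → ∃ k : ℕ, 0 < phTransPow κ U C ε k (F m, F m) z := by
    induction n with
    | zero =>
      rintro m rfl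
      have hz0 : 0 < phTransPow κ U C ε 0 z z := by simp [phTransPow]
      have hstep := phTrans_diag_pos (κ := κ) (U := U) hε0 hε z.1 z.2 fun i => Or.inr (hz i)
      rw [add_zero] at hFN
      exact ⟨1, hFN ▸ phTransPow_succ_pos hκ0 hκ hε0 hε hstep hz0⟩
    | succ n ih =>
      intro m hm
      obtain ⟨k, hk⟩ := ih (m + 1) (by omega)
      exact ⟨k + 2, phTransPow_succ_pos hκ0 hκ hε0 hε (phTrans_diag_pos hε0 hε _ _ (hF m))
        (phTransPow_succ_pos hκ0 hκ hε0 hε (phTrans_repeat_pos hκ0 hκ hε0 hε _ _) hk)⟩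
  exact hdiag N 0 (zero_add N)

end Lemmas

section Theorems

variable {ι : Type*} [Fintype ι] [DecidableEq ι] {A : ι → Type*} [∀ i, Fintype (A i)]

theorem statement5
    (U : ι → (∀ i, A i) → ℝ) (C : ∀ i, A i → Finset (A i))
    (κ : ℝ) (hκ0 : 0 < κ) (hκ : κ ≤ 1 / 2)
    (ε : ℝ) (hε0 : 0 < ε) (hε : ε ≤ 1 / 2) (hA1 : Assumption1 C) :
    (∀ z z' : (∀ i, A i) × (∀ i, A i), memB C z → memB C z' →
      ∃ k : ℕ, 1 ≤ k ∧ 0 < phTransPow κ U C ε k z z') ∧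
    (∀ z : (∀ i, A i) × (∀ i, A i), memB C z →
      ∀ d : ℕ, (∀ k : ℕ, 0 < k → 0 < phTransPow κ U C ε k z z → d ∣ k) → d = 1) := by
  refine ⟨fun z z' _ hz' => ?_, fun z hz d hd => ?_⟩
  · obtain ⟨k, hk⟩ := exists_phTransPow_diag_pos (U := U) hκ0 hκ hε0 hε hA1 z.2 hz'
    exact ⟨k + 1, by omega, phTransPow_succ_pos hκ0 hκ hε0 hε
      (phTrans_repeat_pos hκ0 hκ hε0 hε z.1 z.2) hk⟩
  · obtain ⟨k, hk⟩ := exists_phTransPow_diag_pos (U := U) hκ0 hκ hε0 hε hA1 z.2 hz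
    have hloop := phTransPow_succ_pos hκ0 hκ hε0 hε
      (phTrans_repeat_pos hκ0 hκ hε0 hε z.2 z.2) hk
    have h1 := hd (k + 1) (by omega) (phTransPow_succ_pos hκ0 hκ hε0 hε
      (phTrans_repeat_pos hκ0 hκ hε0 hε z.1 z.2) hk)
    have h2 := hd (k + 1 + 1) (by omega) (phTransPow_succ_pos hκ0 hκ hε0 hε
      (phTrans_repeat_pos hκ0 hκ hε0 hε z.1 z.2) hloop)
    exact Nat.dvd_one.1 ((Nat.dvd_add_right h1).1 h2)

end Theorems
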